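/- Let A₁, B₁, A₂, B₂ be nonempty finite types and let P₁ be a projection on ℂ^(A₁×B₁) and P₂ a projection on ℂ^(A₂×B₂) such that Tr_{B₁}(P₁) and Tr_{B₂}(P₂) are positive definite. Then the semidefinite packing number is multiplicative under tensor products: A(P₁ ⊠ P₂) = A(P₁) · A(P₂). -/

import Mathlib

open Matrix Kronecker BigOperators
open scoped ComplexOrder

noncomputable section

/-- Loewner order: `M ≤ N` iff `N - M` is positive semidefinite. -/
def loe {n : Type*} [Fintype n] (M N : Matrix n n ℂ) : Prop := (N - M).PosSemidef

/-- A projection: Hermitian and idempotent. -/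
def IsProj {n : Type*} [Fintype n] (M : Matrix n n ℂ) : Prop := M.IsHermitian ∧ M * M = M

variable {A B : Type*} [Fintype A] [Fintype B] [DecidableEq A] [DecidableEq B]

/-- Partial trace over `A`. -/
def trA (M : Matrix (A × B) (A × B) ℂ) : Matrix B B ℂ :=
  Matrix.of fun b b' => ∑ a, M (a, b) (a, b')

/-- Partial trace over `B`. -/
def trB (M : Matrix (A × B) (A × B) ℂ) : Matrix A A ℂ :=
  Matrix.of fun a a' => ∑ b, M (a, b) (a', b)

/-- `P` supports a quantum channel: there is a PSD `J` supported on `P` with `Tr_B J = 1`. -/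
def SupportsChannel (P : Matrix (A × B) (A × B) ℂ) : Prop :=
  ∃ J : Matrix (A × B) (A × B) ℂ, J.PosSemidef ∧ P * J = J ∧ trB J = 1

/-- Semidefinite packing number (primal SDP). -/
def Aram (P : Matrix (A × B) (A × B) ℂ) : ℝ :=
  sSup { x : ℝ | ∃ S : Matrix A A ℂ, S.PosSemidef ∧ x = S.trace.re ∧
    loe (trA (P * (S ⊗ₖ (1 : Matrix B B ℂ)))) 1 }

/-- Tensor product of non-commutative bipartite graphs (projections). -/
def boxProd {A₁ B₁ A₂ B₂ : Type*}
    (P₁ : Matrix (A₁ × B₁) (A₁ × B₁) ℂ) (P₂ : Matrix (A₂ × B₂) (A₂ × B₂) ℂ) :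
    Matrix ((A₁ × A₂) × (B₁ × B₂)) ((A₁ × A₂) × (B₁ × B₂)) ℂ :=
  Matrix.of fun x y =>
    P₁ (x.1.1, x.2.1) (y.1.1, y.2.1) * P₂ (x.1.2, x.2.2) (y.1.2, y.2.2)

section Helpers

open scoped MatrixOrder in
theorem psd_fac {n : Type*} [Fintype n] [DecidableEq n] {M : Matrix n n ℂ} (h : M.PosSemidef) :
    ∃ C : Matrix n n ℂ, M = Cᴴ * C := by
  have h' : 0 ≤ M := Matrix.nonneg_iff_posSemidef.2 h
  obtain ⟨C, hC⟩ := CStarAlgebra.nonneg_iff_eq_star_mul_self.1 h'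
  exact ⟨C, hC⟩

theorem psd_trace_mul {n : Type*} [Fintype n] [DecidableEq n] {M N : Matrix n n ℂ}
    (hM : M.PosSemidef) (hN : N.PosSemidef) : 0 ≤ (M * N).trace := by
  obtain ⟨C, rfl⟩ := psd_fac hM
  rw [Matrix.mul_assoc, Matrix.trace_mul_comm]
  exact (hN.mul_mul_conjTranspose_same C).trace_nonneg

theorem psd_of_trace {n : Type*} [Fintype n] [DecidableEq n] {M : Matrix n n ℂ}
    (h : ∀ N : Matrix n n ℂ, N.PosSemidef → 0 ≤ (M * N).trace) : M.PosSemidef := by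
  have key : ∀ x : n → ℂ, 0 ≤ star x ⬝ᵥ (M *ᵥ x) := by
    intro x
    have := h _ (Matrix.posSemidef_vecMulVec_self_star x)
    rwa [Matrix.mul_vecMulVec, Matrix.trace_vecMulVec, dotProduct_comm] at this
  refine Matrix.PosSemidef.of_dotProduct_mulVec_nonneg ?_ key
  rw [← Matrix.isSymmetric_toEuclideanLin_iff, LinearMap.isSymmetric_iff_inner_map_self_real]
  intro v
  have h2 := key v.ofLp
  have h3 := (Complex.nonneg_iff.1 h2).2
  rw [Complex.conj_eq_iff_im]
  rw [EuclideanSpace.inner_eq_star_dotProduct]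
  simp only [Matrix.ofLp_toLpLin, Matrix.toLin'_apply]
  rw [Matrix.dotProduct_star, dotProduct_comm]
  change ((starRingEnd ℂ) _).im = 0
  rw [Complex.conj_im, ← h3, neg_zero]

theorem trace_pos_of_pd {n : Type*} [Fintype n] [DecidableEq n] {M S : Matrix n n ℂ}
    (hM : M.PosDef) (hS : S.PosSemidef) (h0 : S ≠ 0) : 0 < (M * S).trace := by
  obtain ⟨C, rfl⟩ := psd_fac hS
  have hp := hM.posSemidef.mul_mul_conjTranspose_same C
  have e : (M * (Cᴴ * C)).trace = (C * M * Cᴴ).trace := by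
    rw [← Matrix.mul_assoc, Matrix.trace_mul_comm, Matrix.mul_assoc]
  rw [e]
  refine lt_of_le_of_ne hp.trace_nonneg fun h => h0 ?_
  have hz := hp.trace_eq_zero_iff.1 h.symm
  have hC : Cᴴ = 0 := by
    apply Matrix.ext_of_mulVec_single
    intro i
    by_contra hx
    rw [Matrix.zero_mulVec] at hx
    have := hM.dotProduct_mulVec_pos hx
    rw [Matrix.star_mulVec, Matrix.conjTranspose_conjTranspose, ← Matrix.dotProduct_mulVec,
      Matrix.mulVec_mulVec, Matrix.mulVec_mulVec, hz] at this
    simp at this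
  rw [hC, Matrix.zero_mul]

theorem trA_apply (P : Matrix (A × B) (A × B) ℂ) (S : Matrix A A ℂ) (b b' : B) :
    trA (P * (S ⊗ₖ (1 : Matrix B B ℂ))) b b' = ∑ a, ∑ a', P (a, b) (a', b') * S a' a := by
  simp [trA, Matrix.mul_apply, Fintype.sum_prod_type, Matrix.one_apply]

theorem trB_apply (P : Matrix (A × B) (A × B) ℂ) (T : Matrix B B ℂ) (a a' : A) :
    trB (P * ((1 : Matrix A A ℂ) ⊗ₖ T)) a a' = ∑ b, ∑ b', P (a, b) (a', b') * T b' b := by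
  simp only [trB, Matrix.mul_apply, Fintype.sum_prod_type_right, Matrix.one_apply,
    Matrix.of_apply, Matrix.kroneckerMap_apply]
  simp

theorem trace_trA (P : Matrix (A × B) (A × B) ℂ) (S : Matrix A A ℂ) (T : Matrix B B ℂ) :
    (trA (P * (S ⊗ₖ (1 : Matrix B B ℂ))) * T).trace = (P * (S ⊗ₖ T)).trace := by
  simp only [Matrix.trace, Matrix.diag, Matrix.mul_apply, trA_apply, Fintype.sum_prod_type,
    Matrix.kroneckerMap_apply, Finset.sum_mul]
  conv_rhs => rw [Finset.sum_comm]
  refine Finset.sum_congr rfl fun b _ => ?_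
  rw [Finset.sum_comm]
  refine Finset.sum_congr rfl fun a _ => ?_
  rw [Finset.sum_comm]
  refine Finset.sum_congr rfl fun a' _ => Finset.sum_congr rfl fun c _ => ?_
  ring

theorem trace_trB (P : Matrix (A × B) (A × B) ℂ) (S : Matrix A A ℂ) (T : Matrix B B ℂ) :
    (trB (P * ((1 : Matrix A A ℂ) ⊗ₖ T)) * S).trace = (P * (S ⊗ₖ T)).trace := by
  simp only [Matrix.trace, Matrix.diag, Matrix.mul_apply, trB_apply, Fintype.sum_prod_type,
    Matrix.kroneckerMap_apply, Finset.sum_mul]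
  refine Finset.sum_congr rfl fun a _ => ?_
  rw [Finset.sum_comm]
  refine Finset.sum_congr rfl fun b _ => Finset.sum_congr rfl fun a' _ =>
    Finset.sum_congr rfl fun c _ => ?_
  ring

def dens (n : Type*) [Fintype n] : Set (Matrix n n ℂ) := {S | S.PosSemidef ∧ S.trace = 1}

theorem dens_convex {n : Type*} [Fintype n] [DecidableEq n] : Convex ℝ (dens n) := by
  rintro x ⟨hx, hx'⟩ y ⟨hy, hy'⟩ a b ha hb hab
  refine ⟨(hx.smul ha).add (hy.smul hb), ?_⟩
  rw [Matrix.trace_add, Matrix.trace_smul, Matrix.trace_smul, hx', hy', ← add_smul, hab, one_smul]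

theorem dens_compact {n : Type*} [Fintype n] [DecidableEq n] : IsCompact (dens n) := by
  have hK : IsCompact {C : n → n → ℂ | ∑ i, ∑ j, ‖C i j‖ ^ 2 = 1} := by
    refine Metric.isCompact_of_isClosed_isBounded ?_ ?_
    · exact isClosed_eq (by fun_prop) continuous_const
    · refine (Metric.isBounded_closedBall (x := 0) (r := 1)).subset fun C hC => ?_
      rw [mem_closedBall_zero_iff]
      refine (pi_norm_le_iff_of_nonneg zero_le_one).2 fun i =>
        (pi_norm_le_iff_of_nonneg zero_le_one).2 fun j => ?_
      have h1 : ‖C i j‖ ^ 2 ≤ ∑ j, ‖C i j‖ ^ 2 :=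
        Finset.single_le_sum (f := fun j => ‖C i j‖ ^ 2) (fun _ _ => by positivity) (Finset.mem_univ j)
      have h2 : ∑ j, ‖C i j‖ ^ 2 ≤ ∑ i, ∑ j, ‖C i j‖ ^ 2 :=
        Finset.single_le_sum (f := fun i => ∑ j, ‖C i j‖ ^ 2) (fun _ _ => by positivity)
          (Finset.mem_univ i)
      have h3 : ∑ i, ∑ j, ‖C i j‖ ^ 2 = 1 := hC
      nlinarith [norm_nonneg (C i j)]
  have hf : Continuous (fun C : Matrix n n ℂ => Cᴴ * C) := by fun_prop
  have := hK.image hf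
  convert this using 1
  have tr : ∀ C : Matrix n n ℂ, (Cᴴ * C).trace = ((∑ i, ∑ j, ‖C i j‖ ^ 2 : ℝ) : ℂ) := by
    intro C
    rw [Finset.sum_comm]
    simp [Matrix.trace, Matrix.mul_apply, ← Complex.normSq_eq_norm_sq, Complex.normSq_eq_conj_mul_self]
  ext S
  constructor
  · rintro ⟨h, h'⟩
    obtain ⟨C, rfl⟩ := psd_fac h
    refine ⟨C, ?_, rfl⟩
    rw [tr] at h'
    exact_mod_cast h'
  · rintro ⟨C, hC, rfl⟩
    refine ⟨Matrix.posSemidef_conjTranspose_mul_self _, ?_⟩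
    have h3 : ∑ i, ∑ j, ‖C i j‖ ^ 2 = 1 := hC
    have := tr C
    rw [h3] at this
    exact_mod_cast this

theorem dens_unif {n : Type*} [Fintype n] [DecidableEq n] [Nonempty n] :
    ((Fintype.card n : ℝ)⁻¹ • (1 : Matrix n n ℂ)) ∈ dens n := by
  refine ⟨Matrix.PosSemidef.one.smul (by positivity), ?_⟩
  rw [Matrix.trace_smul, Matrix.trace_one, Complex.real_smul]
  have : (Fintype.card n : ℂ) ≠ 0 := by exact_mod_cast Fintype.card_ne_zero
  push_cast
  exact inv_mul_cancel₀ this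

/-- The bilinear form. -/
def bf (P : Matrix (A × B) (A × B) ℂ) (S : Matrix A A ℂ) (T : Matrix B B ℂ) : ℂ :=
  (P * (S ⊗ₖ T)).trace

theorem bf_nonneg {P : Matrix (A × B) (A × B) ℂ} (hP : P.PosSemidef) {S : Matrix A A ℂ}
    {T : Matrix B B ℂ} (hS : S.PosSemidef) (hT : T.PosSemidef) : 0 ≤ bf P S T :=
  psd_trace_mul hP (hS.kronecker hT)

theorem bf_add_left (P : Matrix (A × B) (A × B) ℂ) (S S' : Matrix A A ℂ)
    (T : Matrix B B ℂ) : bf P (S + S') T = bf P S T + bf P S' T := by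
  simp [bf, Matrix.add_kronecker, Matrix.mul_add]

theorem bf_add_right (P : Matrix (A × B) (A × B) ℂ) (S : Matrix A A ℂ)
    (T T' : Matrix B B ℂ) : bf P S (T + T') = bf P S T + bf P S T' := by
  simp [bf, Matrix.kronecker_add, Matrix.mul_add]

theorem bf_smul_left (P : Matrix (A × B) (A × B) ℂ) (r : ℝ) (S : Matrix A A ℂ)
    (T : Matrix B B ℂ) : bf P (r • S) T = r • bf P S T := by
  simp [bf, Matrix.smul_kronecker, Matrix.trace_smul]

theorem bf_smul_right (P : Matrix (A × B) (A × B) ℂ) (r : ℝ) (S : Matrix A A ℂ)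
    (T : Matrix B B ℂ) : bf P S (r • T) = r • bf P S T := by
  simp [bf, Matrix.kronecker_smul, Matrix.trace_smul]

theorem bf_cont_left (P : Matrix (A × B) (A × B) ℂ) (T : Matrix B B ℂ) :
    Continuous fun S => (bf P S T).re := by
  unfold bf
  simp only [Matrix.trace, Matrix.diag, Matrix.mul_apply, Matrix.kroneckerMap_apply]
  fun_prop

theorem bf_cont_right (P : Matrix (A × B) (A × B) ℂ) (S : Matrix A A ℂ) :
    Continuous fun T => (bf P S T).re := by
  unfold bf
  simp only [Matrix.trace, Matrix.diag, Matrix.mul_apply, Matrix.kroneckerMap_apply]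
  fun_prop

theorem psd_trace_eq {n : Type*} [Fintype n] [DecidableEq n] {M : Matrix n n ℂ}
    (h : M.PosSemidef) : M.trace = (M.trace.re : ℂ) :=
  Complex.ext rfl (by simpa using (Complex.nonneg_iff.1 h.trace_nonneg).2.symm)

theorem dens_scale {n : Type*} [Fintype n] [DecidableEq n] {M : Matrix n n ℂ}
    (h : M.PosSemidef) : M = 0 ∨ (0 < M.trace.re ∧ (M.trace.re)⁻¹ • M ∈ dens n) := by
  by_cases h0 : M = 0
  · exact Or.inl h0
  right
  have hn := (Complex.nonneg_iff.1 h.trace_nonneg).1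
  have hne : M.trace.re ≠ 0 := by
    intro h1
    apply h0
    rw [← h.trace_eq_zero_iff, psd_trace_eq h, h1, Complex.ofReal_zero]
  refine ⟨lt_of_le_of_ne hn hne.symm, h.smul (inv_nonneg.2 hn), ?_⟩
  rw [Matrix.trace_smul, Complex.real_smul]
  nth_rw 2 [psd_trace_eq h]
  rw [← Complex.ofReal_mul, inv_mul_cancel₀ hne, Complex.ofReal_one]

theorem saddle [Nonempty A] [Nonempty B] (P : Matrix (A × B) (A × B) ℂ) :
    ∃ a ∈ dens A, ∃ b ∈ dens B, ∀ x ∈ dens A, ∀ y ∈ dens B, (bf P a y).re ≤ (bf P x b).re := by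
  have hl : ∀ y, IsLinearMap ℝ fun x => (bf P x y).re := fun y =>
    ⟨fun _ _ => by simp [bf_add_left], fun _ _ => by simp [bf_smul_left]⟩
  have hr : ∀ x, IsLinearMap ℝ fun y => (bf P x y).re := fun x =>
    ⟨fun _ _ => by simp [bf_add_right], fun _ _ => by simp [bf_smul_right]⟩
  exact Sion.exists_isSaddlePointOn (f := fun x y => (bf P x y).re)
    ⟨_, dens_unif⟩ dens_convex dens_compact
    (fun y _ => (bf_cont_left P y).lowerSemicontinuous.lowerSemicontinuousOn _)
    (fun y _ => (((hl y).mk' _).convexOn dens_convex).quasiconvexOn)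
    dens_convex ⟨_, dens_unif⟩ dens_compact
    (fun x _ => (bf_cont_right P x).upperSemicontinuous.upperSemicontinuousOn _)
    (fun x _ => (((hr x).mk' _).concaveOn dens_convex).quasiconcaveOn)

theorem strong_duality [Nonempty A] [Nonempty B] {P : Matrix (A × B) (A × B) ℂ}
    (hP : P.PosSemidef) (hPD : (trB P).PosDef) :
    ∃ S : Matrix A A ℂ, ∃ T : Matrix B B ℂ, S.PosSemidef ∧ T.PosSemidef ∧
      loe (trA (P * (S ⊗ₖ (1 : Matrix B B ℂ)))) 1 ∧
      loe 1 (trB (P * ((1 : Matrix A A ℂ) ⊗ₖ T))) ∧ S.trace = T.trace := by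
  obtain ⟨a, ha, b, hb, hab⟩ := saddle P
  set v := (bf P a b).re with hv
  have hvpos : 0 < v := by
    refine lt_of_lt_of_le ?_ (hab a ha _ dens_unif)
    have ha0 : a ≠ 0 := by
      rintro rfl
      have := ha.2
      simp at this
    have := trace_pos_of_pd hPD ha.1 ha0
    have e := trace_trB P a 1
    rw [Matrix.one_kronecker_one, Matrix.mul_one] at e
    rw [bf_smul_right, bf, ← e, Complex.smul_re]
    have h2 := (Complex.pos_iff.1 this).1
    have : (0:ℝ) < (Fintype.card B : ℝ)⁻¹ := by
      have : 0 < Fintype.card B := Fintype.card_pos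
      positivity
    exact mul_pos this h2
  have hiv : 0 ≤ v⁻¹ := inv_nonneg.2 hvpos.le
  have h1 : ∀ N : Matrix B B ℂ, N.PosSemidef → (bf P a N).re ≤ v * N.trace.re := by
    intro N hN
    rcases dens_scale hN with rfl | ⟨hpos, hd⟩
    · simp [bf]
    · have := hab a ha _ hd
      rw [bf_smul_right, Complex.smul_re, smul_eq_mul, inv_mul_le_iff₀ hpos] at this
      linarith
  have h2 : ∀ N : Matrix A A ℂ, N.PosSemidef → v * N.trace.re ≤ (bf P N b).re := by
    intro N hN
    rcases dens_scale hN with rfl | ⟨hpos, hd⟩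
    · simp [bf]
    · have := hab _ hd b hb
      rw [bf_smul_left, Complex.smul_re, smul_eq_mul, le_inv_mul_iff₀ hpos] at this
      linarith
  refine ⟨v⁻¹ • a, v⁻¹ • b, ha.1.smul hiv, hb.1.smul hiv, ?_, ?_, ?_⟩
  · refine psd_of_trace fun N hN => ?_
    rw [Matrix.sub_mul, Matrix.trace_sub, trace_trA, Matrix.one_mul]
    change 0 ≤ N.trace - bf P (v⁻¹ • a) N
    rw [bf_smul_left, Complex.nonneg_iff]
    have i1 := (Complex.nonneg_iff.1 hN.trace_nonneg).2
    have i2 := (Complex.nonneg_iff.1 (bf_nonneg hP ha.1 hN)).2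
    constructor
    · rw [Complex.sub_re, Complex.smul_re, smul_eq_mul, sub_nonneg, inv_mul_le_iff₀ hvpos]
      exact h1 N hN
    · simp [← i1, ← i2]
  · refine psd_of_trace fun N hN => ?_
    rw [Matrix.sub_mul, Matrix.trace_sub, trace_trB, Matrix.one_mul]
    change 0 ≤ bf P N (v⁻¹ • b) - N.trace
    rw [bf_smul_right, Complex.nonneg_iff]
    have i1 := (Complex.nonneg_iff.1 hN.trace_nonneg).2
    have i2 := (Complex.nonneg_iff.1 (bf_nonneg hP hN hb.1)).2
    constructor
    · rw [Complex.sub_re, Complex.smul_re, smul_eq_mul, sub_nonneg, le_inv_mul_iff₀ hvpos]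
      exact h2 N hN
    · simp [← i1, ← i2]
  · rw [Matrix.trace_smul, Matrix.trace_smul, ha.2, hb.2]

theorem weak_duality {P : Matrix (A × B) (A × B) ℂ} {S : Matrix A A ℂ} {T : Matrix B B ℂ}
    (hS : S.PosSemidef) (hT : T.PosSemidef)
    (h1 : loe (trA (P * (S ⊗ₖ (1 : Matrix B B ℂ)))) 1)
    (h2 : loe 1 (trB (P * ((1 : Matrix A A ℂ) ⊗ₖ T)))) : S.trace.re ≤ T.trace.re := by
  have e1 := psd_trace_mul h1 hT
  have e2 := psd_trace_mul h2 hS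
  rw [Matrix.sub_mul, Matrix.trace_sub, trace_trA, Matrix.one_mul] at e1
  rw [Matrix.sub_mul, Matrix.trace_sub, trace_trB, Matrix.one_mul] at e2
  have e1 := (Complex.nonneg_iff.1 e1).1
  have e2 := (Complex.nonneg_iff.1 e2).1
  rw [Complex.sub_re] at e1 e2
  linarith

theorem Aram_eq {P : Matrix (A × B) (A × B) ℂ} {S : Matrix A A ℂ} {T : Matrix B B ℂ}
    (hS : S.PosSemidef) (hT : T.PosSemidef)
    (h1 : loe (trA (P * (S ⊗ₖ (1 : Matrix B B ℂ)))) 1)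
    (h2 : loe 1 (trB (P * ((1 : Matrix A A ℂ) ⊗ₖ T)))) (h : S.trace = T.trace) :
    Aram P = S.trace.re := by
  refine IsGreatest.csSup_eq ⟨⟨S, hS, rfl, h1⟩, ?_⟩
  rintro x ⟨S', hS', rfl, h'⟩
  rw [h]
  exact weak_duality hS' hT h' h2

theorem IsProj.psd {n : Type*} [Fintype n] {P : Matrix n n ℂ} (h : IsProj P) :
    P.PosSemidef := by
  have := Matrix.posSemidef_conjTranspose_mul_self P
  rwa [h.1.eq, h.2] at this

theorem trA_psd {P : Matrix (A × B) (A × B) ℂ} (hP : P.PosSemidef) {S : Matrix A A ℂ}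
    (hS : S.PosSemidef) : (trA (P * (S ⊗ₖ (1 : Matrix B B ℂ)))).PosSemidef :=
  psd_of_trace fun N hN => by rw [trace_trA]; exact bf_nonneg hP hS hN

theorem trB_psd {P : Matrix (A × B) (A × B) ℂ} (hP : P.PosSemidef) {T : Matrix B B ℂ}
    (hT : T.PosSemidef) : (trB (P * ((1 : Matrix A A ℂ) ⊗ₖ T))).PosSemidef :=
  psd_of_trace fun N hN => by rw [trace_trB]; exact bf_nonneg hP hN hT

theorem kron_le_one {m n : Type*} [Fintype m] [Fintype n] [DecidableEq m] [DecidableEq n]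
    {M : Matrix m m ℂ} {N : Matrix n n ℂ} (hM : M.PosSemidef)
    (h1 : loe M 1) (h2 : loe N 1) : loe (M ⊗ₖ N) 1 := by
  have e : 1 - M ⊗ₖ N = (1 - M) ⊗ₖ (1 : Matrix n n ℂ) + M ⊗ₖ (1 - N) := by
    rw [← Matrix.one_kronecker_one]
    ext ⟨i, j⟩ ⟨k, l⟩
    simp only [Matrix.sub_apply, Matrix.add_apply, Matrix.kroneckerMap_apply]
    ring
  unfold loe
  rw [e]
  exact (Matrix.PosSemidef.kronecker h1 Matrix.PosSemidef.one).add (hM.kronecker h2)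

theorem one_le_kron {m n : Type*} [Fintype m] [Fintype n] [DecidableEq m] [DecidableEq n]
    {M : Matrix m m ℂ} {N : Matrix n n ℂ} (hN : N.PosSemidef)
    (h1 : loe 1 M) (h2 : loe 1 N) : loe 1 (M ⊗ₖ N) := by
  have e : M ⊗ₖ N - 1 = (M - 1) ⊗ₖ N + (1 : Matrix m m ℂ) ⊗ₖ (N - 1) := by
    rw [← Matrix.one_kronecker_one]
    ext ⟨i, j⟩ ⟨k, l⟩
    simp only [Matrix.sub_apply, Matrix.add_apply, Matrix.kroneckerMap_apply]
    ring
  unfold loe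
  rw [e]
  exact (Matrix.PosSemidef.kronecker h1 hN).add (Matrix.PosSemidef.one.kronecker h2)

variable {A₁ B₁ A₂ B₂ : Type*} [Fintype A₁] [Fintype B₁] [Fintype A₂] [Fintype B₂]
    [DecidableEq A₁] [DecidableEq B₁] [DecidableEq A₂] [DecidableEq B₂]

theorem trA_box (P₁ : Matrix (A₁ × B₁) (A₁ × B₁) ℂ) (P₂ : Matrix (A₂ × B₂) (A₂ × B₂) ℂ)
    (S₁ : Matrix A₁ A₁ ℂ) (S₂ : Matrix A₂ A₂ ℂ) :
    trA (boxProd P₁ P₂ * ((S₁ ⊗ₖ S₂) ⊗ₖ (1 : Matrix (B₁ × B₂) (B₁ × B₂) ℂ))) =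
      trA (P₁ * (S₁ ⊗ₖ (1 : Matrix B₁ B₁ ℂ))) ⊗ₖ trA (P₂ * (S₂ ⊗ₖ (1 : Matrix B₂ B₂ ℂ))) := by
  ext ⟨b₁, b₂⟩ ⟨c₁, c₂⟩
  rw [trA_apply, Matrix.kroneckerMap_apply, trA_apply, trA_apply, Finset.sum_mul_sum]
  simp only [Finset.sum_mul_sum, Fintype.sum_prod_type]
  refine Finset.sum_congr rfl fun _ _ => Finset.sum_congr rfl fun _ _ =>
    Finset.sum_congr rfl fun _ _ => Finset.sum_congr rfl fun _ _ => ?_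
  simp [boxProd]
  ring

theorem trB_box (P₁ : Matrix (A₁ × B₁) (A₁ × B₁) ℂ) (P₂ : Matrix (A₂ × B₂) (A₂ × B₂) ℂ)
    (S₁ : Matrix B₁ B₁ ℂ) (S₂ : Matrix B₂ B₂ ℂ) :
    trB (boxProd P₁ P₂ * ((1 : Matrix (A₁ × A₂) (A₁ × A₂) ℂ) ⊗ₖ (S₁ ⊗ₖ S₂))) =
      trB (P₁ * ((1 : Matrix A₁ A₁ ℂ) ⊗ₖ S₁)) ⊗ₖ trB (P₂ * ((1 : Matrix A₂ A₂ ℂ) ⊗ₖ S₂)) := by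
  ext ⟨b₁, b₂⟩ ⟨c₁, c₂⟩
  rw [trB_apply, Matrix.kroneckerMap_apply, trB_apply, trB_apply, Finset.sum_mul_sum]
  simp only [Finset.sum_mul_sum, Fintype.sum_prod_type]
  refine Finset.sum_congr rfl fun _ _ => Finset.sum_congr rfl fun _ _ =>
    Finset.sum_congr rfl fun _ _ => Finset.sum_congr rfl fun _ _ => ?_
  simp [boxProd]
  ring

end Helpers

/-- The semidefinite packing number is multiplicative under tensor products. -/
theorem aram_multiplicative
    {A₁ B₁ A₂ B₂ : Type*} [Fintype A₁] [Fintype B₁] [Fintype A₂] [Fintype B₂]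
    [DecidableEq A₁] [DecidableEq B₁] [DecidableEq A₂] [DecidableEq B₂]
    [Nonempty A₁] [Nonempty B₁] [Nonempty A₂] [Nonempty B₂]
    (P₁ : Matrix (A₁ × B₁) (A₁ × B₁) ℂ) (P₂ : Matrix (A₂ × B₂) (A₂ × B₂) ℂ)
    (hP₁ : IsProj P₁) (hP₂ : IsProj P₂)
    (hPD₁ : (trB P₁).PosDef) (hPD₂ : (trB P₂).PosDef) :
    Aram (boxProd P₁ P₂) = Aram P₁ * Aram P₂ := by
  obtain ⟨S₁, T₁, hS₁, hT₁, p₁, d₁, e₁⟩ := strong_duality hP₁.psd hPD₁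
  obtain ⟨S₂, T₂, hS₂, hT₂, p₂, d₂, e₂⟩ := strong_duality hP₂.psd hPD₂
  rw [Aram_eq hS₁ hT₁ p₁ d₁ e₁, Aram_eq hS₂ hT₂ p₂ d₂ e₂,
    Aram_eq (P := boxProd P₁ P₂) (hS₁.kronecker hS₂) (hT₁.kronecker hT₂)
      (by rw [trA_box]; exact kron_le_one (trA_psd hP₁.psd hS₁) p₁ p₂)
      (by rw [trB_box]; exact one_le_kron (trB_psd hP₂.psd hT₂) d₁ d₂)
      (by rw [Matrix.trace_kronecker, Matrix.trace_kronecker, e₁, e₂])]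
  rw [Matrix.trace_kronecker, psd_trace_eq hS₁, psd_trace_eq hS₂, ← Complex.ofReal_mul]
  simp only [Complex.ofReal_re]
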